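/- arXiv:1108.2727 — 8 statements merged into one kernel-verified Lean document; each statement's English description precedes it below -/
import Mathlib

section
/- Let φ : ℝ → ℝ be continuously differentiable with φ'(x) > 0 for all x, let α : ℝ → ℝ be continuous, and let U₁, V₁ : ℝ → ℝ be continuously differentiable and U₂, V₂ : ℝ → ℝ be continuous. Define the complex-valued functions TU(x) = (1/(2·√(φ'(x))))·(U₁'(x) + i·U₂(x)·φ'(x))·exp(i·α(x)/2) and TV(x) = (1/(2·√(φ'(x))))·(V₁'(x) + i·V₂(x)·φ'(x))·exp(i·α(x)/2). Then Re ∫₀¹ TU(x)·conj(TV(x)) dx = (1/4)·∫₀¹ ( U₁'(x)·V₁'(x)/φ'(x) + U₂(x)·V₂(x)·φ'(x) ) dx. (This is the statement that the map Φ(φ, α) = √(φ') · exp(iα/2) is a Riemannian isometry from the group G^s with its right-invariant metric onto a subset of the unit sphere of L²(S¹; ℂ).) -/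
theorem stmt_1 (φ α U₁ V₁ U₂ V₂ : ℝ → ℝ)
    (hφ : ContDiff ℝ 1 φ) (hφ' : ∀ x, 0 < deriv φ x)
    (hα : Continuous α)
    (hU₁ : ContDiff ℝ 1 U₁) (hV₁ : ContDiff ℝ 1 V₁)
    (hU₂ : Continuous U₂) (hV₂ : Continuous V₂)
    (TU TV : ℝ → ℂ)
    (hTU : ∀ x, TU x = Complex.ofReal (1 / (2 * Real.sqrt (deriv φ x))) *
      (Complex.ofReal (deriv U₁ x) + Complex.I * Complex.ofReal (U₂ x) * Complex.ofReal (deriv φ x)) *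
      Complex.exp (Complex.I * Complex.ofReal (α x) / 2))
    (hTV : ∀ x, TV x = Complex.ofReal (1 / (2 * Real.sqrt (deriv φ x))) *
      (Complex.ofReal (deriv V₁ x) + Complex.I * Complex.ofReal (V₂ x) * Complex.ofReal (deriv φ x)) *
      Complex.exp (Complex.I * Complex.ofReal (α x) / 2)) :
    (∫ x in (0:ℝ)..1, TU x * (starRingEnd ℂ) (TV x)).re =
      (1 / 4) * ∫ x in (0:ℝ)..1,
        (deriv U₁ x * deriv V₁ x / deriv φ x + U₂ x * V₂ x * deriv φ x) := by
  have cφ : Continuous (deriv φ) := hφ.continuous_deriv le_rfl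
  have cU : Continuous (deriv U₁) := hU₁.continuous_deriv le_rfl
  have cV : Continuous (deriv V₁) := hV₁.continuous_deriv le_rfl
  have cs : Continuous (fun x => 1 / (2 * Real.sqrt (deriv φ x))) := by
    refine Continuous.div continuous_const (by fun_prop) (fun x => ?_)
    have := Real.sqrt_pos.2 (hφ' x)
    positivity
  have cTU : Continuous TU := by
    rw [funext hTU]
    exact ((Complex.continuous_ofReal.comp cs).mul (by fun_prop)).mul (by fun_prop)
  have cTV : Continuous TV := by
    rw [funext hTV]
    exact ((Complex.continuous_ofReal.comp cs).mul (by fun_prop)).mul (by fun_prop)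
  have hc : Continuous (fun x => TU x * (starRingEnd ℂ) (TV x)) :=
    cTU.mul (Complex.continuous_conj.comp cTV)
  have h1 := Complex.reCLM.intervalIntegral_comp_comm (hc.intervalIntegrable (μ := MeasureTheory.volume) 0 1)
  simp only [Complex.reCLM_apply] at h1
  rw [← h1, ← intervalIntegral.integral_const_mul]
  refine intervalIntegral.integral_congr (fun x _ => ?_)
  have hp := hφ' x
  have hs := Real.sqrt_pos.2 hp
  have hsq := Real.sq_sqrt hp.le
  have he : Complex.exp (Complex.I * Complex.ofReal (α x) / 2) *
      (starRingEnd ℂ) (Complex.exp (Complex.I * Complex.ofReal (α x) / 2)) = 1 := by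
    rw [← Complex.exp_conj, ← Complex.exp_add]
    have h2 : (starRingEnd ℂ) 2 = 2 := Complex.conj_ofNat 2
    simp [neg_div, h2]
  have key : TU x * (starRingEnd ℂ) (TV x) =
      Complex.ofReal ((1 / (2 * Real.sqrt (deriv φ x))) ^ 2) *
      ((Complex.ofReal (deriv U₁ x) + Complex.I * Complex.ofReal (U₂ x) * Complex.ofReal (deriv φ x)) *
       (Complex.ofReal (deriv V₁ x) - Complex.I * Complex.ofReal (V₂ x) * Complex.ofReal (deriv φ x))) := by
    rw [hTU, hTV]
    simp only [map_mul, map_add, Complex.conj_ofReal, Complex.conj_I, Complex.ofReal_pow]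
    linear_combination (Complex.ofReal (1 / (2 * Real.sqrt (deriv φ x))) ^ 2 *
      ((Complex.ofReal (deriv U₁ x) + Complex.I * Complex.ofReal (U₂ x) * Complex.ofReal (deriv φ x)) *
       (Complex.ofReal (deriv V₁ x) - Complex.I * Complex.ofReal (V₂ x) * Complex.ofReal (deriv φ x)))) * he
  have hq : (1 / (2 * Real.sqrt (deriv φ x))) ^ 2 = 1 / (4 * deriv φ x) := by
    rw [div_pow, mul_pow, hsq]; norm_num
  simp only [key, hq, Complex.re_ofReal_mul]
  simp
  field_simp
end

section
/- Let a, b : ℝ → ℝ be functions, and let c > 0. Then the following are equivalent: (i) for all t ≥ 0 and all x ∈ ℝ, cos(c·t) + ((a(x) + i·b(x))/(2c))·sin(c·t) ≠ 0; (ii) b(x) ≠ 0 for all x ∈ ℝ. (With a = u₀' and b = ρ₀, this is the criterion that the explicit great-circle solution of the two-component Hunter–Saxton system with initial data (u₀, ρ₀) avoids the vanishing locus for all times, i.e. the solution exists globally, if and only if ρ₀ is nowhere zero.) -/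
theorem stmt_5 (a b : ℝ → ℝ) (c : ℝ) (hc : 0 < c) :
    (∀ t : ℝ, 0 ≤ t → ∀ x : ℝ,
      Complex.ofReal (Real.cos (c * t)) +
        ((Complex.ofReal (a x) + Complex.I * Complex.ofReal (b x)) /
          (2 * Complex.ofReal c)) * Complex.ofReal (Real.sin (c * t)) ≠ 0)
    ↔ ∀ x : ℝ, b x ≠ 0 := by
  have key : ∀ p q C S : ℝ, (Complex.ofReal C +
        ((Complex.ofReal p + Complex.I * Complex.ofReal q) /
          (2 * Complex.ofReal c)) * Complex.ofReal S = 0) ↔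
        (C + p / (2 * c) * S = 0 ∧ q / (2 * c) * S = 0) := by
    intro p q C S
    have h : Complex.ofReal C +
        ((Complex.ofReal p + Complex.I * Complex.ofReal q) /
          (2 * Complex.ofReal c)) * Complex.ofReal S =
        ⟨C + p / (2 * c) * S, q / (2 * c) * S⟩ := by
      rw [Complex.mk_eq_add_mul_I]
      push_cast
      ring
    rw [h, Complex.ext_iff]
    simp only [Complex.zero_re, Complex.zero_im]
  simp only [ne_eq, key]
  constructor
  · intro h x hb
    have h1 := Real.neg_pi_div_two_lt_arctan (a x / (2 * c))
    apply h ((Real.arctan (a x / (2 * c)) + Real.pi / 2) / c)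
      (div_nonneg (by linarith) hc.le) x
    rw [mul_div_cancel₀ _ hc.ne', Real.cos_add_pi_div_two, Real.sin_add_pi_div_two, hb]
    refine ⟨?_, by simp⟩
    have h2 := Real.tan_mul_cos (Real.cos_arctan_pos (a x / (2 * c))).ne'
    rw [Real.tan_arctan] at h2
    linarith
  · rintro h t - x ⟨h1, h2⟩
    have hS : Real.sin (c * t) = 0 :=
      (mul_eq_zero.mp h2).resolve_left (div_ne_zero (h x) (by positivity))
    have h3 := Real.sin_sq_add_cos_sq (c * t)
    rw [hS, mul_zero, add_zero] at h1
    rw [hS, h1] at h3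
    norm_num at h3
end

section
/- Let φ : ℝ → ℝ be continuously differentiable with φ(0) = 0, φ'(x) > 0 for all x, and φ(x+1) = φ(x) + 1 for all x; let α : ℝ → ℝ be continuous and 1-periodic. Set μ₀ = ∫₀¹ √(φ'(x))·cos(α(x)/2) dx and assume −1 < μ₀ < 1. Define r₀ = arccos(μ₀), u₀(x) = (2/√(1 − μ₀²))·∫₀ˣ ( √(φ'(y))·cos(α(y)/2) − μ₀ ) dy, and ρ₀(x) = 2·√(φ'(x))·sin(α(x)/2)/√(1 − μ₀²). Then: (i) u₀(0) = 0 and u₀ is 1-periodic; (ii) (1/4)·∫₀¹ ( u₀'(x)² + ρ₀(x)² ) dx = 1; and (iii) for all x ∈ ℝ, cos(r₀) + ((u₀'(x) + i·ρ₀(x))/2)·sin(r₀) = √(φ'(x))·exp(i·α(x)/2). (Explicit formula for the inverse of the Riemannian exponential map of the group G^s at the identity: the geodesic with unit-length initial velocity (u₀, ρ₀) reaches the point (φ, α) at time r₀.) -/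
theorem stmt_9 (φ α : ℝ → ℝ)
    (hφ : ContDiff ℝ 1 φ) (hφ0 : φ 0 = 0) (hφ' : ∀ x, 0 < deriv φ x)
    (hφper : ∀ x, φ (x + 1) = φ x + 1)
    (hα : Continuous α) (hαper : ∀ x, α (x + 1) = α x)
    (μ₀ : ℝ)
    (hμ₀ : μ₀ = ∫ x in (0:ℝ)..1, Real.sqrt (deriv φ x) * Real.cos (α x / 2))
    (hμ₀1 : -1 < μ₀) (hμ₀2 : μ₀ < 1)
    (r₀ : ℝ) (hr₀ : r₀ = Real.arccos μ₀)
    (u₀ ρ₀ : ℝ → ℝ)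
    (hu₀ : ∀ x, u₀ x = (2 / Real.sqrt (1 - μ₀ ^ 2)) *
      ∫ y in (0:ℝ)..x, (Real.sqrt (deriv φ y) * Real.cos (α y / 2) - μ₀))
    (hρ₀ : ∀ x, ρ₀ x =
      2 * Real.sqrt (deriv φ x) * Real.sin (α x / 2) / Real.sqrt (1 - μ₀ ^ 2)) :
    (u₀ 0 = 0 ∧ ∀ x, u₀ (x + 1) = u₀ x) ∧
    (1 / 4) * (∫ x in (0:ℝ)..1, (deriv u₀ x ^ 2 + ρ₀ x ^ 2)) = 1 ∧
    ∀ x, Complex.ofReal (Real.cos r₀) +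
      ((Complex.ofReal (deriv u₀ x) + Complex.I * Complex.ofReal (ρ₀ x)) / 2) *
        Complex.ofReal (Real.sin r₀)
      = Complex.ofReal (Real.sqrt (deriv φ x)) *
        Complex.exp (Complex.I * Complex.ofReal (α x) / 2) := by
  have hdc : Continuous (deriv φ) := hφ.continuous_deriv le_rfl
  have hd : Differentiable ℝ φ := hφ.differentiable one_ne_zero
  have hdper : ∀ x, deriv φ (x + 1) = deriv φ x := by
    intro x
    rw [← deriv_comp_add_const φ 1 x]
    have : (fun y => φ (y + 1)) = fun y => φ y + 1 := funext hφper
    rw [this, deriv_add_const]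
  obtain ⟨g, hg⟩ : ∃ g : ℝ → ℝ, g = fun x => Real.sqrt (deriv φ x) * Real.cos (α x / 2) := ⟨_, rfl⟩
  have hgx : ∀ x, Real.sqrt (deriv φ x) * Real.cos (α x / 2) = g x := by
    intro x; rw [hg]
  simp only [hgx] at hμ₀ hu₀
  have hgc : Continuous g := by rw [hg]; fun_prop
  have hgper : ∀ x, g (x + 1) = g x := by
    intro x; rw [← hgx, ← hgx, hdper, hαper]
  have hpos : 0 < 1 - μ₀ ^ 2 := by nlinarith
  obtain ⟨s, hs⟩ : ∃ s, s = Real.sqrt (1 - μ₀ ^ 2) := ⟨_, rfl⟩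
  have hs0 : 0 < s := by rw [hs]; exact Real.sqrt_pos.mpr hpos
  have hs2 : s ^ 2 = 1 - μ₀ ^ 2 := by rw [hs]; exact Real.sq_sqrt hpos.le
  rw [← hs] at hu₀
  simp only [← hs] at hρ₀
  have hgm : Continuous fun y => g y - μ₀ := by fun_prop
  have hu' : ∀ x, deriv u₀ x = 2 / s * (g x - μ₀) := by
    intro x
    have h1 := (intervalIntegral.integral_hasDerivAt_right (hgm.intervalIntegrable 0 x)
      (hgm.stronglyMeasurableAtFilter _ _) hgm.continuousAt).const_mul (2 / s)
    rw [funext hu₀]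
    exact h1.deriv
  have hI0 : ∫ y in (0:ℝ)..1, (g y - μ₀) = 0 := by
    rw [intervalIntegral.integral_sub (hgc.intervalIntegrable _ _) (by simp), ← hμ₀]
    simp
  have hIφ : ∫ y in (0:ℝ)..1, deriv φ y = 1 := by
    rw [intervalIntegral.integral_deriv_eq_sub (fun x _ => hd x) (hdc.intervalIntegrable _ _)]
    have := hφper 0
    rw [zero_add] at this
    rw [this]; ring
  refine ⟨⟨by rw [hu₀]; simp, ?_⟩, ?_, ?_⟩
  · intro x
    rw [hu₀, hu₀]
    congr 1
    have hp : Function.Periodic (fun y => g y - μ₀) 1 := by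
      intro y; simp only [hgper]
    rw [← intervalIntegral.integral_add_adjacent_intervals
      (hgm.intervalIntegrable 0 x) (hgm.intervalIntegrable x (x + 1)),
      hp.intervalIntegral_add_eq x 0, zero_add, hI0, add_zero]
  · have hpt : ∀ x, deriv u₀ x ^ 2 + ρ₀ x ^ 2
        = 4 / s ^ 2 * (deriv φ x - 2 * μ₀ * (g x - μ₀) - μ₀ ^ 2) := by
      intro x
      rw [hu', hρ₀]
      have h1 := Real.sq_sqrt (hφ' x).le
      have h2 := Real.sin_sq_add_cos_sq (α x / 2)
      have h3 : (g x) ^ 2 + (Real.sqrt (deriv φ x) * Real.sin (α x / 2)) ^ 2 = deriv φ x := by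
        rw [← hgx]
        linear_combination (Real.sqrt (deriv φ x)) ^ 2 * h2 + h1
      field_simp
      linear_combination 4 * h3
    simp only [hpt]
    rw [intervalIntegral.integral_const_mul, intervalIntegral.integral_sub,
      intervalIntegral.integral_sub, intervalIntegral.integral_const_mul, hI0, hIφ]
    · simp only [intervalIntegral.integral_const, mul_zero, sub_zero, one_smul, ← hs2]
      field_simp
    · exact hdc.intervalIntegrable _ _
    · exact (hgm.const_mul _).intervalIntegrable _ _
    · exact (hdc.sub (hgm.const_mul _)).intervalIntegrable _ _
    · simp
  · intro x
    have hc : Real.cos r₀ = μ₀ := by rw [hr₀, Real.cos_arccos hμ₀1.le hμ₀2.le]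
    have hsn : Real.sin r₀ = s := by rw [hr₀, Real.sin_arccos, hs]
    have he : Complex.exp (Complex.I * Complex.ofReal (α x) / 2)
        = Complex.ofReal (Real.cos (α x / 2)) + Complex.ofReal (Real.sin (α x / 2)) * Complex.I := by
      have : Complex.I * Complex.ofReal (α x) / 2 = Complex.ofReal (α x / 2) * Complex.I := by
        push_cast; ring
      rw [this, Complex.exp_mul_I, Complex.ofReal_cos, Complex.ofReal_sin]
    have hsc : (s : ℂ) ≠ 0 := by exact_mod_cast hs0.ne'
    rw [hc, hsn, he, hu', hρ₀, ← hgx]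
    generalize Real.cos (α x / 2) = c
    generalize Real.sin (α x / 2) = d
    push_cast
    field_simp
    ring
end

section
/- Let z ∈ ℂ and r₀ ∈ (0, π). Then there exists r with 0 < r < r₀ such that sin(r₀ − r) + z·sin(r) = 0 if and only if z is a negative real number (i.e. Im z = 0 and Re z < 0). (Pointwise criterion for the short geodesic segment on the sphere of L²(S¹;ℂ) joining the constant function 1 to a function f to pass through a zero at a given point x with z = f(x).) -/
theorem stmt_11 (z : ℂ) (r₀ : ℝ) (h1 : 0 < r₀) (h2 : r₀ < Real.pi) :
    (∃ r : ℝ, 0 < r ∧ r < r₀ ∧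
      Complex.ofReal (Real.sin (r₀ - r)) + z * Complex.ofReal (Real.sin r) = 0)
    ↔ (z.im = 0 ∧ z.re < 0) := by
  constructor
  · rintro ⟨r, hr, hr', h⟩
    have s1 : 0 < Real.sin (r₀ - r) := Real.sin_pos_of_pos_of_lt_pi (by linarith) (by linarith)
    have s2 : 0 < Real.sin r := Real.sin_pos_of_pos_of_lt_pi hr (by linarith)
    have hre := congrArg Complex.re h
    have him := congrArg Complex.im h
    rw [Complex.add_re, Complex.re_mul_ofReal, Complex.ofReal_re, Complex.zero_re] at hre
    rw [Complex.add_im, Complex.im_mul_ofReal, Complex.ofReal_im, Complex.zero_im, zero_add] at him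
    refine ⟨(mul_eq_zero.mp him).resolve_right s2.ne', ?_⟩
    by_contra hc
    have := mul_nonneg (not_lt.mp hc) s2.le
    linarith
  · rintro ⟨him, hre⟩
    have s0 : 0 < Real.sin r₀ := Real.sin_pos_of_pos_of_lt_pi h1 h2
    have hc : ContinuousOn (fun r : ℝ => Real.sin (r₀ - r) + z.re * Real.sin r) (Set.Icc 0 r₀) := by
      fun_prop
    have hm : (0 : ℝ) ∈ Set.Ioo (Real.sin (r₀ - r₀) + z.re * Real.sin r₀)
        (Real.sin (r₀ - 0) + z.re * Real.sin 0) := by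
      constructor
      · simpa using mul_neg_of_neg_of_pos hre s0
      · simpa using s0
    obtain ⟨r, hr, h⟩ := intermediate_value_Ioo' h1.le hc hm
    refine ⟨r, hr.1, hr.2, ?_⟩
    apply Complex.ext
    · rw [Complex.add_re, Complex.re_mul_ofReal, Complex.ofReal_re, Complex.zero_re]
      exact h
    · rw [Complex.add_im, Complex.im_mul_ofReal, Complex.ofReal_im, Complex.zero_im, him]
      simp
end

section
/- Let φ : ℝ → ℝ be continuously differentiable with φ'(x) > 0 for all x and φ(x+1) = φ(x) + 1 for all x. Let U₁ : ℝ → ℝ be continuously differentiable and 1-periodic with U₁(0) = 0, and let U₂ : ℝ → ℝ be continuous and 1-periodic. Define π(W)(x) = W(x) − ∫₀¹ W(y)·φ'(y) dy for continuous 1-periodic W, and define J(U₁, U₂) = (V₁, V₂) where V₁(x) = −∫₀ˣ π(U₂)(y)·φ'(y) dy and V₂(x) = U₁'(x)/φ'(x). Then: (i) V₁ is 1-periodic with V₁(0) = 0 and V₂ is continuous and 1-periodic; and (ii) J(V₁, V₂) = (−U₁, −π(U₂)), so that applying J twice gives (−U₁, −U₂) up to an additive constant in the second component. (The almost complex structure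 J on the manifold K^s satisfies J² = −I.) -/
theorem stmt_16 (φ U₁ U₂ : ℝ → ℝ)
    (hφ : ContDiff ℝ 1 φ) (hφ' : ∀ x, 0 < deriv φ x)
    (hφper : ∀ x, φ (x + 1) = φ x + 1)
    (hU₁ : ContDiff ℝ 1 U₁) (hU₁per : ∀ x, U₁ (x + 1) = U₁ x) (hU₁0 : U₁ 0 = 0)
    (hU₂ : Continuous U₂) (hU₂per : ∀ x, U₂ (x + 1) = U₂ x)
    (piW : (ℝ → ℝ) → (ℝ → ℝ))
    (hpi : ∀ W x, piW W x = W x - ∫ y in (0:ℝ)..1, W y * deriv φ y)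
    (V₁ V₂ : ℝ → ℝ)
    (hV₁ : ∀ x, V₁ x = -∫ y in (0:ℝ)..x, piW U₂ y * deriv φ y)
    (hV₂ : ∀ x, V₂ x = deriv U₁ x / deriv φ x) :
    ((∀ x, V₁ (x + 1) = V₁ x) ∧ V₁ 0 = 0 ∧
      Continuous V₂ ∧ (∀ x, V₂ (x + 1) = V₂ x)) ∧
    (∀ x, -(∫ y in (0:ℝ)..x, piW V₂ y * deriv φ y) = -U₁ x) ∧
    (∀ x, deriv V₁ x / deriv φ x = -piW U₂ x) := by
  have cφ : Continuous (deriv φ) := hφ.continuous_deriv le_rfl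
  have cU : Continuous (deriv U₁) := hU₁.continuous_deriv le_rfl
  have dφ : Differentiable ℝ φ := hφ.differentiable one_ne_zero
  have dU : Differentiable ℝ U₁ := hU₁.differentiable one_ne_zero
  have pφ : ∀ x, deriv φ (x + 1) = deriv φ x := by
    intro x
    rw [← deriv_comp_add_const, funext hφper, deriv_add_const]
  have pU : ∀ x, deriv U₁ (x + 1) = deriv U₁ x := by
    intro x
    rw [← deriv_comp_add_const, funext hU₁per]
  have Iφ : ∫ y in (0:ℝ)..1, deriv φ y = 1 := by
    rw [intervalIntegral.integral_deriv_eq_sub (fun x _ => dφ x) (cφ.intervalIntegrable _ _)]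
    have := hφper 0
    rw [zero_add] at this
    linarith
  have cpi : Continuous (piW U₂) := by
    rw [funext (hpi U₂)]
    exact hU₂.sub continuous_const
  have cg : Continuous (fun y => piW U₂ y * deriv φ y) := cpi.mul cφ
  have pg : Function.Periodic (fun y => piW U₂ y * deriv φ y) 1 := by
    intro y
    simp only [hpi, pφ, hU₂per]
  have Ig : ∫ y in (0:ℝ)..1, piW U₂ y * deriv φ y = 0 := by
    simp only [hpi, sub_mul]
    rw [intervalIntegral.integral_sub
      (Continuous.intervalIntegrable (by fun_prop) _ _)
      (Continuous.intervalIntegrable (by fun_prop) _ _),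
      intervalIntegral.integral_const_mul, Iφ]
    ring
  have IU : ∀ x, ∫ y in (0:ℝ)..x, deriv U₁ y = U₁ x := by
    intro x
    rw [intervalIntegral.integral_deriv_eq_sub (fun x _ => dU x) (cU.intervalIntegrable _ _),
      hU₁0, sub_zero]
  have hV₂φ : ∀ y, V₂ y * deriv φ y = deriv U₁ y := by
    intro y
    rw [hV₂, div_mul_cancel₀ _ (hφ' y).ne']
  have hpV : ∀ y, piW V₂ y = V₂ y := by
    intro y
    have h1 := hU₁per 0
    rw [zero_add] at h1
    simp only [hpi, hV₂φ, IU, h1, hU₁0, sub_zero]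
  refine ⟨⟨?_, ?_, ?_, ?_⟩, ?_, ?_⟩
  · intro x
    rw [hV₁, hV₁, ← intervalIntegral.integral_add_adjacent_intervals
      (cg.intervalIntegrable 0 x) (cg.intervalIntegrable x (x + 1)),
      pg.intervalIntegral_add_eq x 0, zero_add, Ig, add_zero]
  · simp [hV₁]
  · rw [funext hV₂]
    exact cU.div cφ (fun x => (hφ' x).ne')
  · intro x
    rw [hV₂, hV₂, pφ, pU]
  · intro x
    simp only [hpV, hV₂φ, IU]
  · intro x
    have h : deriv V₁ x = -(piW U₂ x * deriv φ x) := by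
      rw [funext hV₁]
      exact (cg.integral_hasStrictDerivAt 0 x).hasDerivAt.neg.deriv
    rw [h, neg_div, mul_div_cancel_right₀ _ (hφ' x).ne']
end

section
/- Let φ : ℝ → ℝ be continuously differentiable with φ'(x) > 0 for all x and φ(x+1) = φ(x) + 1 for all x. Let U₁, V₁ : ℝ → ℝ be continuously differentiable and 1-periodic with U₁(0) = V₁(0) = 0, and let U₂, V₂ : ℝ → ℝ be continuous and 1-periodic. Define π(W)(x) = W(x) − ∫₀¹ W(y)·φ'(y) dy, the metric g(U, V) = (1/4)·∫₀¹ ( U₁'(x)·V₁'(x)/φ'(x) + π(U₂)(x)·π(V₂)(x)·φ'(x) ) dx, and J(U₁, U₂) = ( −∫₀ˣ π(U₂)(y)·φ'(y) dy , U₁'/φ' ). Then g(J(U₁,U₂), J(V₁,V₂)) = g((U₁,U₂), (V₁,V₂)). (The metric g on the manifold K^s is almost Hermitian with respect to the complex structure J.) -/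
theorem stmt_17 (φ U₁ U₂ V₁ V₂ : ℝ → ℝ)
    (hφ : ContDiff ℝ 1 φ) (hφ' : ∀ x, 0 < deriv φ x)
    (hφper : ∀ x, φ (x + 1) = φ x + 1)
    (hU₁ : ContDiff ℝ 1 U₁) (hU₁per : ∀ x, U₁ (x + 1) = U₁ x) (hU₁0 : U₁ 0 = 0)
    (hV₁ : ContDiff ℝ 1 V₁) (hV₁per : ∀ x, V₁ (x + 1) = V₁ x) (hV₁0 : V₁ 0 = 0)
    (hU₂ : Continuous U₂) (hU₂per : ∀ x, U₂ (x + 1) = U₂ x)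
    (hV₂ : Continuous V₂) (hV₂per : ∀ x, V₂ (x + 1) = V₂ x)
    (piW : (ℝ → ℝ) → (ℝ → ℝ))
    (hpi : ∀ W x, piW W x = W x - ∫ y in (0:ℝ)..1, W y * deriv φ y)
    (g : ((ℝ → ℝ) × (ℝ → ℝ)) → ((ℝ → ℝ) × (ℝ → ℝ)) → ℝ)
    (hgdef : ∀ P Q, g P Q = (1 / 4) * ∫ x in (0:ℝ)..1,
      (deriv P.1 x * deriv Q.1 x / deriv φ x + piW P.2 x * piW Q.2 x * deriv φ x))
    (J : ((ℝ → ℝ) × (ℝ → ℝ)) → ((ℝ → ℝ) × (ℝ → ℝ)))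
    (hJ : ∀ P, J P = (fun x => -∫ y in (0:ℝ)..x, piW P.2 y * deriv φ y,
      fun x => deriv P.1 x / deriv φ x)) :
    g (J (U₁, U₂)) (J (V₁, V₂)) = g (U₁, U₂) (V₁, V₂) := by
  have hφc : Continuous (deriv φ) := hφ.continuous_deriv le_rfl
  have hpc : ∀ W, Continuous W → Continuous (fun y => piW W y * deriv φ y) := by
    intro W hW
    simp only [hpi]
    exact (hW.sub continuous_const).mul hφc
  have hd : ∀ W, Continuous W → ∀ x,
      deriv (fun x => -∫ y in (0:ℝ)..x, piW W y * deriv φ y) x = -(piW W x * deriv φ x) := by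
    intro W hW x
    exact ((hpc W hW).integral_hasStrictDerivAt 0 x).hasDerivAt.neg.deriv
  have hq : ∀ F : ℝ → ℝ, ContDiff ℝ 1 F → (∀ x, F (x + 1) = F x) → ∀ x,
      piW (fun x => deriv F x / deriv φ x) x = deriv F x / deriv φ x := by
    intro F hF hper x
    have h1 : ∀ y, deriv F y / deriv φ y * deriv φ y = deriv F y :=
      fun y => div_mul_cancel₀ _ (hφ' y).ne'
    have h2 : ∫ y in (0:ℝ)..1, deriv F y = F 1 - F 0 :=
      intervalIntegral.integral_deriv_eq_sub
        (fun y _ => (hF.differentiable one_ne_zero) y)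
        ((hF.continuous_deriv le_rfl).intervalIntegrable 0 1)
    have h3 : F 1 = F 0 := by simpa using hper 0
    rw [hpi]
    simp only [h1]
    rw [h2, h3]
    ring
  rw [hgdef, hgdef, hJ, hJ]
  congr 1
  apply intervalIntegral.integral_congr
  intro x _
  simp only []
  rw [hd U₂ hU₂, hd V₂ hV₂, hq U₁ hU₁ hU₁per, hq V₁ hV₁ hV₁per]
  have := (hφ' x).ne'
  field_simp
  ring
end

section
/- Let φ : ℝ → ℝ be continuously differentiable with φ'(x) > 0 for all x and φ(x+1) = φ(x) + 1 for all x. Let U₁, V₁ : ℝ → ℝ be continuously differentiable and 1-periodic with U₁(0) = V₁(0) = 0, and let U₂, V₂ : ℝ → ℝ be continuously differentiable and 1-periodic. Define π(W)(x) = W(x) − ∫₀¹ W(y)·φ'(y) dy, the two-form ω(U, V) = (1/4)·∫₀¹ ( U₂'(x)·V₁(x) − V₂'(x)·U₁(x) ) dx, the metric g(U, V) = (1/4)·∫₀¹ ( U₁'·V₁'/φ' + π(U₂)·π(V₂)·φ' ) dx, and J(U₁, U₂) = ( −∫₀ˣ π(U₂)(y)·φ'(y) dy , U₁'/φ' ).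 Then ω((U₁,U₂), (V₁,V₂)) = g(J(U₁,U₂), (V₁,V₂)); explicitly, (1/4)·∫₀¹ ( U₂'·V₁ − V₂'·U₁ ) dx = (1/4)·∫₀¹ ( −π(U₂)·V₁' + U₁'·π(V₂) ) dx. (Compatibility of the symplectic form ω, the metric g and the complex structure J on the Kähler manifold K^s.) -/
theorem stmt_18 (φ U₁ U₂ V₁ V₂ : ℝ → ℝ)
    (hφ : ContDiff ℝ 1 φ) (hφ' : ∀ x, 0 < deriv φ x)
    (hφper : ∀ x, φ (x + 1) = φ x + 1)
    (hU₁ : ContDiff ℝ 1 U₁) (hU₁per : ∀ x, U₁ (x + 1) = U₁ x) (hU₁0 : U₁ 0 = 0)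
    (hV₁ : ContDiff ℝ 1 V₁) (hV₁per : ∀ x, V₁ (x + 1) = V₁ x) (hV₁0 : V₁ 0 = 0)
    (hU₂ : ContDiff ℝ 1 U₂) (hU₂per : ∀ x, U₂ (x + 1) = U₂ x)
    (hV₂ : ContDiff ℝ 1 V₂) (hV₂per : ∀ x, V₂ (x + 1) = V₂ x)
    (piW : (ℝ → ℝ) → (ℝ → ℝ))
    (hpi : ∀ W x, piW W x = W x - ∫ y in (0:ℝ)..1, W y * deriv φ y)
    (ω : ((ℝ → ℝ) × (ℝ → ℝ)) → ((ℝ → ℝ) × (ℝ → ℝ)) → ℝ)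
    (hω : ∀ P Q, ω P Q = (1 / 4) * ∫ x in (0:ℝ)..1,
      (deriv P.2 x * Q.1 x - deriv Q.2 x * P.1 x))
    (g : ((ℝ → ℝ) × (ℝ → ℝ)) → ((ℝ → ℝ) × (ℝ → ℝ)) → ℝ)
    (hgdef : ∀ P Q, g P Q = (1 / 4) * ∫ x in (0:ℝ)..1,
      (deriv P.1 x * deriv Q.1 x / deriv φ x + piW P.2 x * piW Q.2 x * deriv φ x))
    (J : ((ℝ → ℝ) × (ℝ → ℝ)) → ((ℝ → ℝ) × (ℝ → ℝ)))
    (hJ : ∀ P, J P = (fun x => -∫ y in (0:ℝ)..x, piW P.2 y * deriv φ y,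
      fun x => deriv P.1 x / deriv φ x)) :
    ω (U₁, U₂) (V₁, V₂) = g (J (U₁, U₂)) (V₁, V₂) ∧
    (1 / 4) * (∫ x in (0:ℝ)..1, (deriv U₂ x * V₁ x - deriv V₂ x * U₁ x)) =
      (1 / 4) * ∫ x in (0:ℝ)..1,
        (-(piW U₂ x) * deriv V₁ x + deriv U₁ x * piW V₂ x) := by
  have cφ : Continuous (deriv φ) := hφ.continuous_deriv le_rfl
  have cU₁ : Continuous (deriv U₁) := hU₁.continuous_deriv le_rfl
  have cV₁ : Continuous (deriv V₁) := hV₁.continuous_deriv le_rfl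
  have cU₂ : Continuous (deriv U₂) := hU₂.continuous_deriv le_rfl
  have cV₂ : Continuous (deriv V₂) := hV₂.continuous_deriv le_rfl
  have c1 := hU₁.continuous
  have c2 := hV₁.continuous
  have c3 := hU₂.continuous
  have c4 := hV₂.continuous
  have d : ∀ f : ℝ → ℝ, ContDiff ℝ 1 f → ∀ x, HasDerivAt f (deriv f x) x :=
    fun f hf x => (hf.differentiable one_ne_zero x).hasDerivAt
  have hU1 : U₁ 1 = 0 := by have := hU₁per 0; rw [zero_add] at this; rw [this, hU₁0]
  have hV1 : V₁ 1 = 0 := by have := hV₁per 0; rw [zero_add] at this; rw [this, hV₁0]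
  have key : (∫ x in (0:ℝ)..1, (deriv U₂ x * V₁ x - deriv V₂ x * U₁ x)) =
      ∫ x in (0:ℝ)..1, (-(piW U₂ x) * deriv V₁ x + deriv U₁ x * piW V₂ x) := by
    simp only [hpi]
    generalize (∫ y in (0:ℝ)..1, U₂ y * deriv φ y) = a
    generalize (∫ y in (0:ℝ)..1, V₂ y * deriv φ y) = b
    rw [← sub_eq_zero, ← intervalIntegral.integral_sub
      (Continuous.intervalIntegrable (by fun_prop) _ _)
      (Continuous.intervalIntegrable (by fun_prop) _ _)]
    rw [intervalIntegral.integral_eq_sub_of_hasDerivAt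
      (f := fun x => (U₂ x - a) * V₁ x - (V₂ x - b) * U₁ x)]
    · simp [hU1, hV1, hU₁0, hV₁0]
    · intro x _
      have := (((d U₂ hU₂ x).sub_const a).mul (d V₁ hV₁ x)).sub
        (((d V₂ hV₂ x).sub_const b).mul (d U₁ hU₁ x))
      refine this.congr_deriv ?_
      ring
    · exact Continuous.intervalIntegrable (by fun_prop) _ _
  refine ⟨?_, by rw [key]⟩
  rw [hω, hgdef, hJ]
  simp only
  rw [key]
  congr 1
  apply intervalIntegral.integral_congr
  intro x _
  have e1 : deriv (fun x => -∫ y in (0:ℝ)..x, piW U₂ y * deriv φ y) x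
      = -(piW U₂ x * deriv φ x) := by
    have hc : Continuous (fun y => piW U₂ y * deriv φ y) := by
      simp only [hpi]
      fun_prop
    exact (hc.integral_hasStrictDerivAt 0 x).hasDerivAt.neg.deriv
  have e2 : piW (fun x => deriv U₁ x / deriv φ x) x = deriv U₁ x / deriv φ x := by
    rw [hpi]
    have : (∫ y in (0:ℝ)..1, deriv U₁ y / deriv φ y * deriv φ y) = 0 := by
      simp only [div_mul_cancel₀ _ (hφ' _).ne']
      rw [intervalIntegral.integral_eq_sub_of_hasDerivAt (fun x _ => d U₁ hU₁ x)
        (cU₁.intervalIntegrable _ _), hU1, hU₁0, sub_zero]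
    rw [this, sub_zero]
  have := (hφ' x).ne'
  simp only [e1, e2]
  field_simp
end

section
/- Let u₁, v₁ : ℝ → ℝ be continuously differentiable and 1-periodic with u₁(0) = v₁(0) = 0, and let u₂, v₂ : ℝ → ℝ be continuously differentiable and 1-periodic with ∫₀¹ u₂(x) dx = ∫₀¹ v₂(x) dx = 0. Write u = (u₁, u₂), v = (v₁, v₂), and define ⟨u, v⟩ = (1/4)·∫₀¹ ( u₁'(x)·v₁'(x) + u₂(x)·v₂(x) ) dx, ‖u‖² = ⟨u, u⟩, and ω(u, v) = (1/4)·∫₀¹ ( u₂'(x)·v₁(x) − v₂'(x)·u₁(x) ) dx. Then ω(u, v)² + ⟨u, v⟩² ≤ ‖u‖²·‖v‖². Consequently, setting Q = ‖u‖²·‖v‖² − ⟨u, v⟩², one has Q ≤ Q + 3·ω(u, v)² ≤ 4·Q; that is, the sectional curvature of the Kähler manifold K^s at the identity, sec(u, v) = (Q + 3·ω(u,v)²)/Q, satisfies 1 ≤ sec(u, v) ≤ 4 whenever Q ≠ 0. -/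
theorem stmt_19 (u₁ v₁ u₂ v₂ : ℝ → ℝ)
    (hu₁ : ContDiff ℝ 1 u₁) (hu₁per : ∀ x, u₁ (x + 1) = u₁ x) (hu₁0 : u₁ 0 = 0)
    (hv₁ : ContDiff ℝ 1 v₁) (hv₁per : ∀ x, v₁ (x + 1) = v₁ x) (hv₁0 : v₁ 0 = 0)
    (hu₂ : ContDiff ℝ 1 u₂) (hu₂per : ∀ x, u₂ (x + 1) = u₂ x)
    (hv₂ : ContDiff ℝ 1 v₂) (hv₂per : ∀ x, v₂ (x + 1) = v₂ x)
    (hu₂m : ∫ x in (0:ℝ)..1, u₂ x = 0) (hv₂m : ∫ x in (0:ℝ)..1, v₂ x = 0)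
    (ip ω nu nv Q : ℝ)
    (hip : ip = (1 / 4) * ∫ x in (0:ℝ)..1, (deriv u₁ x * deriv v₁ x + u₂ x * v₂ x))
    (hω : ω = (1 / 4) * ∫ x in (0:ℝ)..1, (deriv u₂ x * v₁ x - deriv v₂ x * u₁ x))
    (hnu : nu = (1 / 4) * ∫ x in (0:ℝ)..1, (deriv u₁ x ^ 2 + u₂ x ^ 2))
    (hnv : nv = (1 / 4) * ∫ x in (0:ℝ)..1, (deriv v₁ x ^ 2 + v₂ x ^ 2))
    (hQ : Q = nu * nv - ip ^ 2) :
    ω ^ 2 + ip ^ 2 ≤ nu * nv ∧ Q ≤ Q + 3 * ω ^ 2 ∧ Q + 3 * ω ^ 2 ≤ 4 * Q := by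
  have cu₁ : Continuous (deriv u₁) := hu₁.continuous_deriv le_rfl
  have cv₁ : Continuous (deriv v₁) := hv₁.continuous_deriv le_rfl
  have cu₂' : Continuous (deriv u₂) := hu₂.continuous_deriv le_rfl
  have cv₂' : Continuous (deriv v₂) := hv₂.continuous_deriv le_rfl
  have cu₂ := hu₂.continuous
  have cv₂ := hv₂.continuous
  have c1 := hu₁.continuous
  have c2 := hv₁.continuous
  have hu₁1 : u₁ 1 = 0 := by simpa [hu₁0] using hu₁per 0
  have hv₁1 : v₁ 1 = 0 := by simpa [hv₁0] using hv₁per 0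
  have hd : ∀ f : ℝ → ℝ, ContDiff ℝ 1 f → ∀ x, HasDerivAt f (deriv f x) x := fun f hf x =>
    ((hf.differentiable one_ne_zero) x).hasDerivAt
  have hω' : ∫ x in (0:ℝ)..1, (deriv u₂ x * v₁ x - deriv v₂ x * u₁ x)
      = ∫ x in (0:ℝ)..1, (deriv u₁ x * v₂ x - u₂ x * deriv v₁ x) := by
    have key : ∫ x in (0:ℝ)..1, ((deriv u₂ x * v₁ x - deriv v₂ x * u₁ x)
        - (deriv u₁ x * v₂ x - u₂ x * deriv v₁ x)) = 0 := by
      have := intervalIntegral.integral_eq_sub_of_hasDerivAt (a := 0) (b := 1)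
        (f := fun x => u₂ x * v₁ x - v₂ x * u₁ x)
        (f' := fun x => ((deriv u₂ x * v₁ x - deriv v₂ x * u₁ x)
          - (deriv u₁ x * v₂ x - u₂ x * deriv v₁ x)))
        (fun x _ => by
          have := ((hd u₂ hu₂ x).mul (hd v₁ hv₁ x)).sub ((hd v₂ hv₂ x).mul (hd u₁ hu₁ x))
          exact this.congr_deriv (by ring))
        (Continuous.intervalIntegrable (by fun_prop) _ _)
      rw [this]
      simp [hu₁1, hv₁1, hu₁0, hv₁0]
    rw [intervalIntegral.integral_sub (Continuous.intervalIntegrable (by fun_prop) _ _)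
      (Continuous.intervalIntegrable (by fun_prop) _ _)] at key
    linarith
  rw [hω'] at hω
  have main : ∀ s t : ℝ, 0 ≤ nu - 2 * s * ip - 2 * t * ω + (s ^ 2 + t ^ 2) * nv := by
    intro s t
    have h0 : 0 ≤ ∫ x in (0:ℝ)..1, ((deriv u₁ x - s * deriv v₁ x - t * v₂ x) ^ 2
        + (u₂ x - s * v₂ x + t * deriv v₁ x) ^ 2) :=
      intervalIntegral.integral_nonneg zero_le_one (fun x _ => by positivity)
    have h1 : ∀ x, (deriv u₁ x - s * deriv v₁ x - t * v₂ x) ^ 2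
        + (u₂ x - s * v₂ x + t * deriv v₁ x) ^ 2
        = (deriv u₁ x ^ 2 + u₂ x ^ 2)
          - (2 * s) * (deriv u₁ x * deriv v₁ x + u₂ x * v₂ x)
          - (2 * t) * (deriv u₁ x * v₂ x - u₂ x * deriv v₁ x)
          + (s ^ 2 + t ^ 2) * (deriv v₁ x ^ 2 + v₂ x ^ 2) := fun x => by ring
    simp_rw [h1] at h0
    rw [intervalIntegral.integral_add (Continuous.intervalIntegrable (by fun_prop) _ _)
        (Continuous.intervalIntegrable (by fun_prop) _ _),
      intervalIntegral.integral_sub (Continuous.intervalIntegrable (by fun_prop) _ _)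
        (Continuous.intervalIntegrable (by fun_prop) _ _),
      intervalIntegral.integral_sub (Continuous.intervalIntegrable (by fun_prop) _ _)
        (Continuous.intervalIntegrable (by fun_prop) _ _),
      intervalIntegral.integral_const_mul, intervalIntegral.integral_const_mul,
      intervalIntegral.integral_const_mul] at h0
    rw [hnu, hnv, hip, hω]
    linarith
  have hnu0 : 0 ≤ nu := by simpa using main 0 0
  have hnv0 : 0 ≤ nv := by
    rw [hnv]
    exact mul_nonneg (by norm_num)
      (intervalIntegral.integral_nonneg zero_le_one (fun x _ => by positivity))
  have fin : ω ^ 2 + ip ^ 2 ≤ nu * nv := by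
    have hc0 : 0 ≤ ω ^ 2 + ip ^ 2 := by positivity
    rcases hc0.eq_or_lt with h | hpos
    · rw [← h]; positivity
    have := discrim_le_zero (a := (ω ^ 2 + ip ^ 2) * nv) (b := -2 * (ω ^ 2 + ip ^ 2)) (c := nu)
      (fun k => by
        have := main (k * ip) (k * ω)
        nlinarith [this])
    unfold discrim at this
    refine le_of_mul_le_mul_left ?_ hpos
    nlinarith [this]
  refine ⟨fin, ?_, ?_⟩
  · nlinarith [sq_nonneg ω]
  · rw [hQ]; linarith
end
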